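/- arXiv:1810.08657 — 2 statements merged into one kernel-verified Lean document; each statement's English description precedes it below -/
import Mathlib

section
/- Let n and r be integers with n ≥ 2 and 1 ≤ r ≤ n − 1. Then every finite simple graph G of order n with CR(G) = 0 and γ_CR(G) = r satisfies |E(G)| ≥ n − r, and there exists a finite simple graph G of order n with CR(G) = 0, γ_CR(G) = r, and |E(G)| = n − r. In other words, m(n,0,r) = n − r. -/
open SimpleGraph Set

/-- The closed neighborhood `N[v]` of a vertex `v`. -/
def closedNbhd {V : Type*} (G : SimpleGraph V) (v : V) : Set V :=
  insert v (G.neighborSet v)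

/-- `S` is a dominating set of `G`: every vertex lies in `N[s]` for some `s ∈ S`. -/
def IsDomSet {V : Type*} (G : SimpleGraph V) (S : Set V) : Prop :=
  ∀ v : V, ∃ s ∈ S, v ∈ closedNbhd G s

/-- `CR(S)`: the number of vertices overdominated by `S`, i.e. with `|N[x] ∩ S| ≥ 2`. -/
noncomputable def crOf {V : Type*} (G : SimpleGraph V) (S : Set V) : ℕ :=
  {x : V | 2 ≤ (closedNbhd G x ∩ S).ncard}.ncard

/-- `CR(G)`: the minimum of `CR(S)` over all dominating sets `S` of `G`. -/
noncomputable def crNum {V : Type*} (G : SimpleGraph V) : ℕ :=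
  sInf {k : ℕ | ∃ S : Set V, IsDomSet G S ∧ crOf G S = k}

/-- `γ_CR(G)`: the minimum cardinality of a dominating set `S` with `CR(S) = CR(G)`. -/
noncomputable def gammaCR {V : Type*} (G : SimpleGraph V) : ℕ :=
  sInf {r : ℕ | ∃ S : Set V, IsDomSet G S ∧ crOf G S = crNum G ∧ S.ncard = r}

theorem mem_closedNbhd {V : Type*} {G : SimpleGraph V} {u v : V} :
    u ∈ closedNbhd G v ↔ u = v ∨ G.Adj v u := by
  simp [closedNbhd]

theorem mem_closedNbhd_comm {V : Type*} {G : SimpleGraph V} {u v : V} :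
    u ∈ closedNbhd G v ↔ v ∈ closedNbhd G u := by
  simp [mem_closedNbhd, eq_comm, G.adj_comm]

/-- `CR(S) = 0` means that every closed neighborhood meets `S` in at most one vertex. -/
theorem crOf_eq_zero_iff {V : Type*} [Finite V] {G : SimpleGraph V} {S : Set V} :
    crOf G S = 0 ↔
      ∀ x, ∀ a ∈ S, ∀ b ∈ S, a ∈ closedNbhd G x → b ∈ closedNbhd G x → a = b := by
  have key (x : V) : ¬ 2 ≤ (closedNbhd G x ∩ S).ncard ↔
      ∀ a ∈ S, ∀ b ∈ S, a ∈ closedNbhd G x → b ∈ closedNbhd G x → a = b := by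
    rw [not_le, Nat.lt_succ_iff, Set.ncard_le_one_iff (Set.toFinite _)]
    exact ⟨fun h a ha b hb hax hbx => h ⟨hax, ha⟩ ⟨hbx, hb⟩,
      fun h a b ha hb => h a ha.2 b hb.2 ha.1 hb.1⟩
  rw [crOf, Set.ncard_eq_zero (Set.toFinite _), Set.eq_empty_iff_forall_notMem]
  exact forall_congr' key

theorem ncard_le_of_crOf_eq_zero {V : Type*} [Finite V] {G : SimpleGraph V} {S T : Set V}
    (hS : crOf G S = 0) (hT : IsDomSet G T) : S.ncard ≤ T.ncard := by
  rw [crOf_eq_zero_iff] at hS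
  choose f hfT hf using hT
  refine Set.ncard_le_ncard_of_injOn f (fun v _ => hfT v) (fun a ha b hb hab => ?_)
    (Set.toFinite _)
  exact hS (f a) a ha b hb (hf a) (hab ▸ hf b)

theorem crNum_eq_zero {V : Type*} {G : SimpleGraph V} {S : Set V}
    (hd : IsDomSet G S) (hS : crOf G S = 0) : crNum G = 0 :=
  Nat.eq_zero_of_le_zero (Nat.sInf_le ⟨S, hd, hS⟩)

theorem gammaCR_eq_ncard {V : Type*} [Finite V] {G : SimpleGraph V} {S : Set V}
    (hd : IsDomSet G S) (hS : crOf G S = 0) : gammaCR G = S.ncard := by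
  have h0 := crNum_eq_zero hd hS
  have hmem : S.ncard ∈ {r : ℕ | ∃ S : Set V, IsDomSet G S ∧ crOf G S = crNum G ∧ S.ncard = r} :=
    ⟨S, hd, hS.trans h0.symm, rfl⟩
  refine le_antisymm (Nat.sInf_le hmem) (le_csInf ⟨_, hmem⟩ ?_)
  rintro _ ⟨T, hT, -, rfl⟩
  exact ncard_le_of_crOf_eq_zero hS hT

theorem exists_isDomSet_crOf_eq_crNum {V : Type*} (G : SimpleGraph V) :
    ∃ S : Set V, IsDomSet G S ∧ crOf G S = crNum G :=
  Nat.sInf_mem (s := {k : ℕ | ∃ S : Set V, IsDomSet G S ∧ crOf G S = k})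
    ⟨_, Set.univ, fun v => ⟨v, trivial, mem_closedNbhd.2 (Or.inl rfl)⟩, rfl⟩

/-- Each vertex outside a dominating set `S` contributes its own edge into `S`. -/
theorem ncard_compl_le_ncard_edgeSet {V : Type*} [Finite V] {G : SimpleGraph V} {S : Set V}
    (hd : IsDomSet G S) : Sᶜ.ncard ≤ G.edgeSet.ncard := by
  choose f hfS hf using hd
  refine Set.ncard_le_ncard_of_injOn (fun v => s(f v, v)) (fun v hv => ?_)
    (fun a ha b hb hab => ?_) (Set.toFinite _)
  · rcases mem_closedNbhd.1 (hf v) with h | h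
    · exact absurd (h ▸ hfS v) hv
    · exact h
  · rcases Sym2.eq_iff.1 hab with ⟨-, h⟩ | ⟨h, -⟩
    · exact h
    · exact absurd (h ▸ hfS a) hb

/-- A star with center `0` and leaves `r, …, n - 1`, together with isolated vertices
`1, …, r - 1`. -/
def starWithIsolated (n r : ℕ) : SimpleGraph (Fin n) :=
  SimpleGraph.fromRel fun i j => i.val = 0 ∧ r ≤ j.val

theorem starWithIsolated_adj {n r : ℕ} (hr : 1 ≤ r) {i j : Fin n} :
    (starWithIsolated n r).Adj i j ↔
      (i.val = 0 ∧ r ≤ j.val) ∨ (j.val = 0 ∧ r ≤ i.val) := by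
  simp only [starWithIsolated, SimpleGraph.fromRel_adj, ne_eq, Fin.ext_iff]
  omega

theorem isDomSet_starWithIsolated {n r : ℕ} (hr : 1 ≤ r) :
    IsDomSet (starWithIsolated n r) {i | i.val < r} := by
  intro v
  by_cases hv : v.val < r
  · exact ⟨v, hv, mem_closedNbhd.2 (Or.inl rfl)⟩
  · exact ⟨⟨0, by omega⟩, hr, mem_closedNbhd.2 <| Or.inr <|
      (starWithIsolated_adj hr).2 <| Or.inl ⟨rfl, by omega⟩⟩

theorem crOf_starWithIsolated {n r : ℕ} (hr : 1 ≤ r) :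
    crOf (starWithIsolated n r) {i | i.val < r} = 0 := by
  rw [crOf_eq_zero_iff]
  intro x a ha b hb hax hbx
  simp only [mem_closedNbhd, starWithIsolated_adj hr, Fin.ext_iff, Set.mem_ofPred_eq] at *
  omega

theorem ncard_edgeSet_starWithIsolated {n r : ℕ} (hr : 1 ≤ r) (hn : 1 ≤ n) :
    (starWithIsolated n r).edgeSet.ncard = ({i : Fin n | i.val < r}ᶜ : Set (Fin n)).ncard := by
  refine le_antisymm ?_ (ncard_compl_le_ncard_edgeSet (isDomSet_starWithIsolated hr))
  have hsub : (starWithIsolated n r).edgeSet ⊆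
      (fun v => s((⟨0, hn⟩ : Fin n), v)) '' {i : Fin n | i.val < r}ᶜ := by
    intro e
    induction e using Sym2.ind with
    | h i j =>
      intro h
      rcases (starWithIsolated_adj hr).1 h with ⟨h0, h1⟩ | ⟨h0, h1⟩
      · exact ⟨j, not_lt.2 h1, by rw [show i = ⟨0, hn⟩ from Fin.ext h0]⟩
      · exact ⟨i, not_lt.2 h1, by rw [show j = ⟨0, hn⟩ from Fin.ext h0, Sym2.eq_swap]⟩
  exact (Set.ncard_le_ncard hsub (Set.toFinite _)).trans (Set.ncard_image_le (Set.toFinite _))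

theorem m_n_zero_r (n r : ℕ) (hn : 2 ≤ n) (hr1 : 1 ≤ r) (hr2 : r ≤ n - 1) :
    (∀ (V : Type) [Fintype V] (G : SimpleGraph V), Fintype.card V = n →
        crNum G = 0 → gammaCR G = r →
        n - r ≤ G.edgeSet.ncard) ∧
    (∃ G : SimpleGraph (Fin n), crNum G = 0 ∧ gammaCR G = r ∧
        G.edgeSet.ncard = n - r) := by
  
  refine ⟨fun V _ G hV h0 hγ => ?_, starWithIsolated n r, ?_⟩
  · obtain ⟨S, hd, hS⟩ := exists_isDomSet_crOf_eq_crNum G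
    have h1 := gammaCR_eq_ncard hd (hS.trans h0)
    have h2 := Set.ncard_add_ncard_compl S
    have h3 := ncard_compl_le_ncard_edgeSet hd
    rw [Nat.card_eq_fintype_card] at h2
    omega
  · have hd := isDomSet_starWithIsolated (n := n) hr1
    have hS := crOf_starWithIsolated (n := n) hr1
    have hcard : {i : Fin n | i.val < r}.ncard = r := by
      rw [Set.ncard_eq_toFinset_card', Set.toFinset_ofPred, Fin.card_filter_val_lt]
      omega
    have hcompl := Set.ncard_add_ncard_compl {i : Fin n | i.val < r}
    rw [Nat.card_eq_fintype_card, Fintype.card_fin] at hcompl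
    refine ⟨crNum_eq_zero hd hS, (gammaCR_eq_ncard hd hS).trans hcard, ?_⟩
    rw [ncard_edgeSet_starWithIsolated hr1 (by omega)]
    omega
end

section
/- Let n and r be integers with n ≥ 5 and 2 ≤ r ≤ n − 3. Then every finite simple graph G of order n with CR(G) = 1 and γ_CR(G) = r satisfies |E(G)| ≤ C(n−r, 2) + (n − 2), and there exists a finite simple graph G of order n with CR(G) = 1, γ_CR(G) = r, and |E(G)| = C(n−r, 2) + (n − 2). In other words, M(n,1,r) = C(n−r, 2) + (n − 2). -/
open SimpleGraph Set

section Overdomination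

variable {V : Type*} {G : SimpleGraph V} {S : Set V}

theorem mem_closedNbhd_iff {v u : V} : u ∈ closedNbhd G v ↔ u = v ∨ G.Adj v u := by
  simp [closedNbhd]

theorem crNum_le_crOf (hS : IsDomSet G S) : crNum G ≤ crOf G S :=
  Nat.sInf_le ⟨S, hS, rfl⟩

variable [Finite V]

theorem overdominated_iff {x : V} :
    2 ≤ (closedNbhd G x ∩ S).ncard ↔
      ∃ a ∈ S, ∃ b ∈ S, a ≠ b ∧ (a = x ∨ G.Adj x a) ∧ (b = x ∨ G.Adj x b) := by
  change 1 < _ ↔ _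
  rw [Set.one_lt_ncard]
  simp only [Set.mem_inter_iff, mem_closedNbhd_iff]
  grind

theorem crOf_pos_of_overdominated {x : V} (hx : 2 ≤ (closedNbhd G x ∩ S).ncard) :
    0 < crOf G S :=
  (Set.ncard_pos).2 ⟨x, hx⟩

theorem one_lt_crOf_of_overdominated {x y : V} (hxy : x ≠ y)
    (hx : 2 ≤ (closedNbhd G x ∩ S).ncard) (hy : 2 ≤ (closedNbhd G y ∩ S).ncard) :
    1 < crOf G S :=
  (Set.one_lt_ncard).2 ⟨x, hx, y, hy, hxy⟩

theorem crOf_singleton (x : V) : crOf G {x} = 0 := by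
  refine (Set.ncard_eq_zero).2 (Set.eq_empty_iff_forall_notMem.2 fun y hy => ?_)
  obtain ⟨a, rfl, b, rfl, hab, -⟩ := overdominated_iff.1 hy
  exact hab rfl

end Overdomination

section EdgeCount

variable {V : Type*} [Fintype V] [DecidableEq V] (G : SimpleGraph V) [DecidableRel G.Adj]

/-- Edge count of a graph whose vertices split into a set `D` and an independent complement. -/
theorem two_mul_ncard_edgeSet_of_independent_compl (D : Finset V)
    (hD : ∀ a ∉ D, ∀ b ∉ D, ¬ G.Adj a b) :
    2 * G.edgeSet.ncard = 2 * ∑ v ∈ D, {u ∈ Dᶜ | G.Adj v u}.card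
      + ∑ v ∈ D, {u ∈ D | G.Adj v u}.card := by
  have hdeg : ∀ v, G.degree v = {u ∈ Dᶜ | G.Adj v u}.card + {u ∈ D | G.Adj v u}.card := by
    intro v
    rw [← G.card_neighborFinset_eq_degree, ← Finset.card_union_of_disjoint]
    · congr 1
      ext u
      simp only [mem_neighborFinset, Finset.mem_union, Finset.mem_filter, Finset.mem_compl]
      tauto
    · rw [Finset.disjoint_left]
      simp only [Finset.mem_filter, Finset.mem_compl]
      tauto
  have hcompl : ∑ v ∈ Dᶜ, G.degree v = ∑ v ∈ D, {u ∈ Dᶜ | G.Adj v u}.card := by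
    have h := Finset.sum_card_bipartiteAbove_eq_sum_card_bipartiteBelow
      (s := D) (t := Dᶜ) G.Adj
    simp only [Finset.bipartiteAbove, Finset.bipartiteBelow] at h
    rw [h]
    refine Finset.sum_congr rfl fun v hv => ?_
    rw [hdeg, Finset.card_eq_zero.2, zero_add]
    · simp only [G.adj_comm]
    · rw [Finset.filter_eq_empty_iff]
      intro u hu
      exact hD v (Finset.mem_compl.1 hv) u (Finset.mem_compl.1 hu)
  have hsum := G.sum_degrees_eq_twice_card_edges
  rw [← Finset.sum_add_sum_compl D, hcompl, Finset.sum_congr rfl fun v _ => hdeg v,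
    Finset.sum_add_distrib] at hsum
  rw [← G.coe_edgeFinset, Set.ncard_coe_finset]
  omega

end EdgeCount

theorem ncard_edgeSet_le_of_crNum_eq_one {V : Type*} [Fintype V] (G : SimpleGraph V)
    (hcr : crNum G = 1) (hγ : gammaCR G ≠ 0) :
    G.edgeSet.ncard ≤ (Fintype.card V - gammaCR G).choose 2 + (Fintype.card V - 2) := by
  classical
  obtain ⟨S', -, hcrS, hcard⟩ := Nat.sInf_mem (Nat.nonempty_of_pos_sInf (Nat.pos_of_ne_zero hγ))
  change _ = gammaCR G at hcard
  obtain ⟨D, rfl⟩ : ∃ D : Finset V, S' = ↑(Dᶜ) := ⟨S'.toFinsetᶜ, by simp⟩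
  rw [Set.ncard_coe_finset] at hcard
  rw [hcr] at hcrS
  obtain ⟨x, hx⟩ := Set.ncard_eq_one.1 hcrS
  have hover : ∀ y, (2 ≤ (closedNbhd G y ∩ ↑(Dᶜ)).ncard) ↔ y = x := by
    intro y
    exact Set.ext_iff.1 hx y
  have hind : ∀ a ∉ D, ∀ b ∉ D, ¬ G.Adj a b := by
    intro a ha b hb hab
    have h1 := (hover a).1 (overdominated_iff.2
      ⟨a, by simpa using ha, b, by simpa using hb, hab.ne, Or.inl rfl, Or.inr hab⟩)
    have h2 := (hover b).1 (overdominated_iff.2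
      ⟨a, by simpa using ha, b, by simpa using hb, hab.ne, Or.inr hab.symm, Or.inl rfl⟩)
    exact hab.ne (h1.trans h2.symm)
  have hxD : x ∈ D := by
    by_contra hxD
    obtain ⟨a, ha, b, hb, hab, ha', hb'⟩ := overdominated_iff.1 ((hover x).2 rfl)
    simp only [Finset.coe_compl, Set.mem_compl_iff, Finset.mem_coe] at ha hb
    have := hind x hxD a ha
    have := hind x hxD b hb
    grind
  have hout : ∀ v ∈ D.erase x, {u ∈ Dᶜ | G.Adj v u}.card ≤ 1 := by
    intro v hv
    rw [Finset.card_le_one]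
    intro a ha b hb
    by_contra hab
    simp only [Finset.mem_filter] at ha hb
    exact (Finset.ne_of_mem_erase hv) ((hover v).1 (overdominated_iff.2
      ⟨a, by simpa using ha.1, b, by simpa using hb.1, hab, Or.inr ha.2, Or.inr hb.2⟩))
  have hsumout : ∑ v ∈ D, {u ∈ Dᶜ | G.Adj v u}.card
      ≤ {u ∈ Dᶜ | G.Adj x u}.card + (D.card - 1) := by
    rw [← Finset.add_sum_erase _ _ hxD, ← Finset.card_erase_of_mem hxD]
    exact Nat.add_le_add_left (by simpa using Finset.sum_le_sum hout) _
  have hin : ∀ v ∈ D, {u ∈ D | G.Adj v u} ⊆ D.erase v := by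
    intro v hv u hu
    rw [Finset.mem_filter] at hu
    exact Finset.mem_erase.2 ⟨hu.2.ne', hu.1⟩
  have hin_card : ∀ v ∈ D, {u ∈ D | G.Adj v u}.card ≤ D.card - 1 := by
    intro v hv
    rw [← Finset.card_erase_of_mem hv]
    exact Finset.card_le_card (hin v hv)
  have hin_card_of_not_adj : ∀ v ∈ D, ∀ w ∈ D, v ≠ w → ¬ G.Adj v w →
      {u ∈ D | G.Adj v u}.card ≤ D.card - 2 := by
    intro v hv w hw hvw hadj
    have : {u ∈ D | G.Adj v u} ⊆ (D.erase v).erase w := by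
      intro u hu
      refine Finset.mem_erase.2 ⟨?_, hin v hv hu⟩
      rintro rfl
      exact hadj (Finset.mem_filter.1 hu).2
    have h := Finset.card_le_card this
    rw [Finset.card_erase_of_mem (Finset.mem_erase.2 ⟨hvw.symm, hw⟩),
      Finset.card_erase_of_mem hv] at h
    omega
  have hedge := two_mul_ncard_edgeSet_of_independent_compl G D hind
  have hD1 : 1 ≤ D.card := Finset.card_pos.2 ⟨x, hxD⟩
  have hcompl : Dᶜ.card + D.card = Fintype.card V := Finset.card_compl_add_card D
  have hchoose : 2 * D.card.choose 2 = D.card * (D.card - 1) := by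
    rw [Nat.choose_two_right, Nat.mul_div_cancel' (Nat.even_mul_pred_self _).two_dvd]
  rw [show Fintype.card V - gammaCR G = D.card by omega]
  have hout_le : {u ∈ Dᶜ | G.Adj x u}.card ≤ Dᶜ.card := Finset.card_filter_le _ _
  rcases hout_le.lt_or_eq with hlt | heq
  · have hsumin : ∑ v ∈ D, {u ∈ D | G.Adj v u}.card ≤ D.card * (D.card - 1) := by
      simpa using Finset.sum_le_sum hin_card
    omega
  · rw [Finset.card_filter_eq_iff] at heq
    obtain ⟨w, hw⟩ : ∃ w, w ∉ closedNbhd G x := by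
      by_contra! h
      have := crNum_le_crOf (G := G) (S := {x}) fun v => ⟨x, rfl, h v⟩
      rw [crOf_singleton] at this
      omega
    rw [mem_closedNbhd_iff, not_or] at hw
    have hwD : w ∈ D := by
      by_contra h
      exact hw.2 (heq w (Finset.mem_compl.2 h))
    have h1 := hin_card_of_not_adj x hxD w hwD (Ne.symm hw.1) hw.2
    have h2 := hin_card_of_not_adj w hwD x hxD hw.1 fun h => hw.2 h.symm
    have hwx : w ∈ D.erase x := Finset.mem_erase.2 ⟨hw.1, hwD⟩
    have hrest : ∑ v ∈ (D.erase x).erase w, {u ∈ D | G.Adj v u}.card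
        ≤ ((D.erase x).erase w).card * (D.card - 1) := by
      simpa using Finset.sum_le_sum fun v hv =>
        hin_card v (Finset.mem_of_mem_erase (Finset.mem_of_mem_erase hv))
    have hD2 : 2 ≤ D.card :=
      Finset.one_lt_card.2 ⟨x, hxD, w, hwD, Ne.symm hw.1⟩
    rw [← Finset.add_sum_erase D (fun v => {u ∈ D | G.Adj v u}.card) hxD,
      ← Finset.add_sum_erase (D.erase x) (fun v => {u ∈ D | G.Adj v u}.card) hwx] at hedge
    rw [Finset.card_erase_of_mem hwx, Finset.card_erase_of_mem hxD] at hrest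
    obtain ⟨k, hk⟩ := Nat.exists_eq_add_of_le' hD2
    have hmul : D.card * (D.card - 1) = k * (k + 1) + 2 * k + 2 := by
      rw [hk, show k + 2 - 1 = k + 1 by omega]
      ring
    have hmul' : (D.card - 1 - 1) * (D.card - 1) = k * (k + 1) := by
      rw [hk, show k + 2 - 1 = k + 1 by omega, Nat.add_sub_cancel]
    omega

/-- The extremal graph on `Fin n`: a clique on the indices below `m` with the edge `01` removed,
where the remaining vertices are independent and adjacent to `0`, vertex `m` is moreover adjacent
to `1`, and vertex `m + 1` to each of `2, …, m - 1`. -/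
def extremalGraph (n m : ℕ) : SimpleGraph (Fin n) :=
  SimpleGraph.fromRel fun i j : Fin n => i.val < j.val ∧
    ((j.val < m ∧ ¬ (i.val = 0 ∧ j.val = 1)) ∨ (i.val = 0 ∧ m ≤ j.val) ∨
      (i.val = 1 ∧ j.val = m) ∨ (2 ≤ i.val ∧ i.val < m ∧ j.val = m + 1))

section ExtremalGraph

variable {n m : ℕ}

theorem extremalGraph_adj (i j : Fin n) : (extremalGraph n m).Adj i j ↔
    (i.val < j.val ∧
    ((j.val < m ∧ ¬ (i.val = 0 ∧ j.val = 1)) ∨ (i.val = 0 ∧ m ≤ j.val) ∨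
      (i.val = 1 ∧ j.val = m) ∨ (2 ≤ i.val ∧ i.val < m ∧ j.val = m + 1))) ∨
    (j.val < i.val ∧
    ((i.val < m ∧ ¬ (j.val = 0 ∧ i.val = 1)) ∨ (j.val = 0 ∧ m ≤ i.val) ∨
      (j.val = 1 ∧ i.val = m) ∨ (2 ≤ j.val ∧ j.val < m ∧ i.val = m + 1))) := by
  rw [extremalGraph, SimpleGraph.fromRel_adj, Ne, Fin.ext_iff]
  omega

theorem extremalGraph_isDomSet (hmn : m + 2 ≤ n) :
    IsDomSet (extremalGraph n m) {v | m ≤ v.val} := by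
  intro v
  simp only [mem_closedNbhd_iff, extremalGraph_adj, Set.mem_ofPred_eq, Fin.ext_iff]
  by_cases h : m ≤ v.val
  · exact ⟨v, h, Or.inl rfl⟩
  · by_cases h1 : v.val ≤ 1
    · exact ⟨⟨m, by omega⟩, le_rfl, by dsimp only; omega⟩
    · exact ⟨⟨m + 1, by omega⟩, by simp, by dsimp only; omega⟩

theorem extremalGraph_crOf_le (hm : 3 ≤ m) :
    crOf (extremalGraph n m) {v | m ≤ v.val} ≤ 1 := by
  refine (Set.ncard_le_one).2 ?_
  have : ∀ x : Fin n, 2 ≤ (closedNbhd (extremalGraph n m) x ∩ {v | m ≤ v.val}).ncard →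
      x.val = 0 := by
    intro x hx
    obtain ⟨a, ha, b, hb, hab, ha', hb'⟩ := overdominated_iff.1 hx
    simp only [extremalGraph_adj, Set.mem_ofPred_eq, Fin.ext_iff, Ne] at *
    omega
  intro a ha b hb
  exact Fin.ext ((this a ha).trans (this b hb).symm)

theorem extremalGraph_one_lt_crOf (hm : 3 ≤ m) (hmn : m + 2 ≤ n) {T : Set (Fin n)}
    (hT : IsDomSet (extremalGraph n m) T) {x : Fin n} (hx : x.val = 0) (hxT : x ∈ T) :
    1 < crOf (extremalGraph n m) T := by
  obtain ⟨t, htT, ht⟩ := hT ⟨1, by omega⟩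
  have hxt : x ≠ t := by
    rintro rfl
    simp only [mem_closedNbhd_iff, extremalGraph_adj, true_and, and_true, Fin.ext_iff] at ht
    omega
  simp only [mem_closedNbhd_iff, extremalGraph_adj, true_and, and_true, Fin.ext_iff] at ht
  by_cases h1 : t.val = 1
  · refine one_lt_crOf_of_overdominated (x := ⟨2, by omega⟩) (y := ⟨m, by omega⟩)
      (by simp [Fin.ext_iff]; omega)
      (overdominated_iff.2 ⟨x, hxT, t, htT, hxt, ?_, ?_⟩)
      (overdominated_iff.2 ⟨x, hxT, t, htT, hxt, ?_, ?_⟩) <;>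
    · simp only [extremalGraph_adj, and_true, Fin.ext_iff]
      omega
  · refine one_lt_crOf_of_overdominated hxt
      (overdominated_iff.2 ⟨x, hxT, t, htT, hxt, Or.inl rfl, Or.inr ?_⟩)
      (overdominated_iff.2 ⟨x, hxT, t, htT, hxt, Or.inr ?_, Or.inl rfl⟩) <;>
    · simp only [extremalGraph_adj]
      omega

theorem extremalGraph_crOf_pos (hm : 3 ≤ m) (hmn : m + 2 ≤ n) {T : Set (Fin n)}
    (hT : IsDomSet (extremalGraph n m) T) : 0 < crOf (extremalGraph n m) T := by
  by_cases hx : (⟨0, by omega⟩ : Fin n) ∈ T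
  · exact zero_lt_one.trans (extremalGraph_one_lt_crOf hm hmn hT rfl hx)
  obtain ⟨t, htT, ht⟩ := hT ⟨m, by omega⟩
  obtain ⟨u, huT, hu⟩ := hT ⟨m + 1, by omega⟩
  have ht0 : t.val ≠ 0 := fun h => hx (by convert htT using 1; exact Fin.ext h.symm)
  have hu0 : u.val ≠ 0 := fun h => hx (by convert huT using 1; exact Fin.ext h.symm)
  simp only [mem_closedNbhd_iff, extremalGraph_adj, and_true, Fin.ext_iff] at ht hu
  have htu : t ≠ u := by
    rw [Ne, Fin.ext_iff]
    omega
  by_cases h1 : t.val = 1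
  · refine crOf_pos_of_overdominated (x := ⟨2, by omega⟩)
      (overdominated_iff.2 ⟨t, htT, u, huT, htu, ?_, ?_⟩) <;>
    · simp only [extremalGraph_adj, Fin.ext_iff]
      omega
  · refine crOf_pos_of_overdominated (x := ⟨0, by omega⟩)
      (overdominated_iff.2 ⟨t, htT, u, huT, htu, ?_, ?_⟩) <;>
    · simp only [extremalGraph_adj, true_and, Fin.ext_iff]
      omega

theorem extremalGraph_crNum (hm : 3 ≤ m) (hmn : m + 2 ≤ n) :
    crNum (extremalGraph n m) = 1 := by
  have hdom := extremalGraph_isDomSet hmn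
  refine le_antisymm ((crNum_le_crOf hdom).trans (extremalGraph_crOf_le hm)) ?_
  refine le_csInf ⟨_, _, hdom, rfl⟩ ?_
  rintro _ ⟨T, hT, rfl⟩
  exact extremalGraph_crOf_pos hm hmn hT

theorem ncard_val_lt (hmn : m ≤ n) : {v : Fin n | v.val < m}.ncard = m := by
  have : {v : Fin n | v.val < m} = Set.range (Fin.castLE hmn) := by
    ext v
    simp [Fin.range_castLE]
  rw [this, ← Set.image_univ, Set.ncard_image_of_injective _ (Fin.castLE_injective hmn)]
  simp

theorem ncard_le_val (hmn : m ≤ n) : {v : Fin n | m ≤ v.val}.ncard = n - m := by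
  have h := Set.ncard_add_ncard_compl {v : Fin n | v.val < m}
  have h' : {v : Fin n | v.val < m}ᶜ = {v : Fin n | m ≤ v.val} := by
    ext v
    simp
  rw [ncard_val_lt hmn, h', Nat.card_eq_fintype_card, Fintype.card_fin] at h
  omega

theorem extremalGraph_gammaCR (hm : 3 ≤ m) (hmn : m + 2 ≤ n) :
    gammaCR (extremalGraph n m) = n - m := by
  have hmem : n - m ∈ {r : ℕ | ∃ S : Set (Fin n), IsDomSet (extremalGraph n m) S ∧
      crOf (extremalGraph n m) S = crNum (extremalGraph n m) ∧ S.ncard = r} := by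
    have hdom := extremalGraph_isDomSet hmn
    refine ⟨_, hdom, le_antisymm ?_ (crNum_le_crOf hdom), ncard_le_val (by omega)⟩
    rw [extremalGraph_crNum hm hmn]
    exact extremalGraph_crOf_le hm
  refine le_antisymm (Nat.sInf_le hmem) (le_csInf ⟨_, hmem⟩ ?_)
  rintro _ ⟨T, hT, hcr, rfl⟩
  rw [extremalGraph_crNum hm hmn] at hcr
  choose f hfT hf using hT
  rw [← ncard_le_val (n := n) (m := m) (by omega)]
  refine Set.ncard_le_ncard_of_injOn f (fun v _ => hfT v) ?_
  intro a ha b hb hab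
  have ha' := hf a
  have hb' := hf b
  have h0 : (f a).val ≠ 0 := fun h =>
    (extremalGraph_one_lt_crOf hm hmn (fun v => ⟨f v, hfT v, hf v⟩) h (hfT a)).ne' hcr
  rw [← hab] at hb'
  simp only [mem_closedNbhd_iff, extremalGraph_adj, Set.mem_ofPred_eq, Fin.ext_iff] at *
  omega

theorem extremalGraph_ncard_edgeSet (hm : 3 ≤ m) (hmn : m + 2 ≤ n) :
    (extremalGraph n m).edgeSet.ncard = m.choose 2 + (n - 2) := by
  classical
  set D : Finset (Fin n) := {v | v.val < m} with hD
  have hDcard : D.card = m := by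
    rw [← Set.ncard_coe_finset, hD, Finset.coe_filter_univ]
    exact ncard_val_lt (by omega)
  have hDcompl : Dᶜ.card = n - m := by
    rw [Finset.card_compl, hDcard, Fintype.card_fin]
  have hmemD : ∀ v, v ∈ D ↔ v.val < m := by simp [hD]
  have hedge := two_mul_ncard_edgeSet_of_independent_compl (extremalGraph n m) D (by
    intro a ha b hb
    rw [hmemD] at ha hb
    rw [extremalGraph_adj]
    omega)
  let x : Fin n := ⟨0, by omega⟩
  let w : Fin n := ⟨1, by omega⟩
  have hxD : x ∈ D := (hmemD x).2 (by simp [x]; omega)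
  have hwD : w ∈ D.erase x := by
    rw [Finset.mem_erase, hmemD, Ne, Fin.ext_iff]
    simp only [x, w]
    omega
  have hout_x : {u ∈ Dᶜ | (extremalGraph n m).Adj x u} = Dᶜ := by
    rw [Finset.filter_eq_self]
    intro u hu
    rw [Finset.mem_compl, hmemD] at hu
    simp only [extremalGraph_adj, true_and, x]
    omega
  have hout : ∀ v ∈ D.erase x, {u ∈ Dᶜ | (extremalGraph n m).Adj v u}.card = 1 := by
    intro v hv
    rw [Finset.mem_erase, hmemD, Ne, Fin.ext_iff] at hv
    rw [Finset.card_eq_one]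
    refine ⟨if v.val = 1 then ⟨m, by omega⟩ else ⟨m + 1, by omega⟩, ?_⟩
    ext u
    simp only [x] at hv
    simp only [Finset.mem_filter, Finset.mem_compl, hmemD, extremalGraph_adj,
      Finset.mem_singleton, Fin.ext_iff]
    split_ifs <;> dsimp only <;> omega
  have hin_x : {u ∈ D | (extremalGraph n m).Adj x u} = (D.erase x).erase w := by
    ext u
    simp only [Finset.mem_filter, Finset.mem_erase, hmemD, extremalGraph_adj, true_and, Ne,
      Fin.ext_iff, x, w]
    omega
  have hin_w : {u ∈ D | (extremalGraph n m).Adj w u} = (D.erase x).erase w := by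
    ext u
    simp only [Finset.mem_filter, Finset.mem_erase, hmemD, extremalGraph_adj, true_and, and_true,
      Ne, Fin.ext_iff, x, w]
    omega
  have hin : ∀ v ∈ (D.erase x).erase w,
      {u ∈ D | (extremalGraph n m).Adj v u}.card = m - 1 := by
    intro v hv
    have hvD := Finset.mem_of_mem_erase (Finset.mem_of_mem_erase hv)
    rw [← hDcard, ← Finset.card_erase_of_mem hvD]
    congr 1
    ext u
    simp only [Finset.mem_filter, Finset.mem_erase, hmemD, extremalGraph_adj, true_and, and_true,
      Ne, Fin.ext_iff, x, w] at *
    omega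
  have hcard1 : (D.erase x).card = m - 1 := by rw [Finset.card_erase_of_mem hxD, hDcard]
  have hcard2 : ((D.erase x).erase w).card = m - 1 - 1 := by
    rw [Finset.card_erase_of_mem hwD, hcard1]
  rw [← Finset.add_sum_erase D (fun v => {u ∈ Dᶜ | (extremalGraph n m).Adj v u}.card) hxD,
    ← Finset.add_sum_erase D (fun v => {u ∈ D | (extremalGraph n m).Adj v u}.card) hxD,
    ← Finset.add_sum_erase (D.erase x)
      (fun v => {u ∈ D | (extremalGraph n m).Adj v u}.card) hwD,
    Finset.sum_congr rfl hout, Finset.sum_congr rfl hin, hout_x, hin_x, hin_w,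
    Finset.sum_const, Finset.sum_const, hcard1, hcard2, hDcompl] at hedge
  have hchoose : 2 * m.choose 2 = m * (m - 1) := by
    rw [Nat.choose_two_right, Nat.mul_div_cancel' (Nat.even_mul_pred_self _).two_dvd]
  obtain ⟨k, rfl⟩ := Nat.exists_eq_add_of_le' hm
  simp only [smul_eq_mul, show k + 3 - 1 = k + 2 by omega, show k + 2 - 1 = k + 1 by omega]
    at hedge hchoose
  have h1 : (k + 3) * (k + 2) = k * k + 5 * k + 6 := by ring
  have h2 : (k + 1) * (k + 2) = k * k + 3 * k + 2 := by ring
  omega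

end ExtremalGraph

theorem M_n_one_r (n r : ℕ) (hn : 5 ≤ n) (hr1 : 2 ≤ r) (hr2 : r ≤ n - 3) :
    (∀ (V : Type) [Fintype V] (G : SimpleGraph V), Fintype.card V = n →
        crNum G = 1 → gammaCR G = r →
        G.edgeSet.ncard ≤ (n - r).choose 2 + (n - 2)) ∧
    (∃ G : SimpleGraph (Fin n), crNum G = 1 ∧ gammaCR G = r ∧
        G.edgeSet.ncard = (n - r).choose 2 + (n - 2)) := by
  refine ⟨?_, ?_⟩
  · rintro V _ G rfl hcr rfl
    exact ncard_edgeSet_le_of_crNum_eq_one G hcr (by omega)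
  · have hm : 3 ≤ n - r := by omega
    have hmn : n - r + 2 ≤ n := by omega
    refine ⟨extremalGraph n (n - r), extremalGraph_crNum hm hmn, ?_,
      extremalGraph_ncard_edgeSet hm hmn⟩
    rw [extremalGraph_gammaCR hm hmn]
    omega
end
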